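/- Let m and d be natural numbers with d ≥ 1. Let f be a homogeneous polynomial of degree d in m variables over ℂ, let h be a homogeneous polynomial of degree d-1 in the same variables such that h(x) ≠ 0 for every nonzero x : Fin m → ℂ at which all m partial derivatives of f vanish, and let p be any polynomial in the same variables of total degree at most d-2. Then for all but finitely many c ∈ ℂ, writing g_c = f + h + p + c and letting G_c = Σ_{i=0}^{d} (g_c)_i · z^{d-i} be the degree-d homogenization of g_c in m+1 variables with new variable z, there is no nonzero point y : Fin (m+1) → ℂ at which G_c and all m+1 partial derivatives of G_c vanish simultaneously. In other words, for all but finitely many constant terms c the projective hypersurface {G_c = 0} in P^m is smooth. -/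

import Mathlib

open MvPolynomial

/-- The degree-`d` homogenization of a polynomial `g` in `m` variables:
`G = Σ_{i=0}^{d} g_i · z^{d-i}`, where `g_i` is the degree-`i` homogeneous component
of `g` (regarded as a polynomial in the first `m` of `m+1` variables) and
`z = X (Fin.last m)` is the new variable. -/
noncomputable def homogenization (m d : ℕ) (g : MvPolynomial (Fin m) ℂ) :
    MvPolynomial (Fin (m + 1)) ℂ :=
  ∑ i ∈ Finset.range (d + 1),
    (rename (Fin.castSucc : Fin m → Fin (m + 1)) (homogeneousComponent i g))
      * (X (Fin.last m)) ^ (d - i)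

open scoped TensorProduct

/-- In characteristic zero, an element with vanishing Kähler differential is algebraic. -/
theorem isAlgebraic_of_kaehlerDifferential_eq_zero {K L : Type*} [Field K] [CharZero K]
    [Field L] [Algebra K L] [Algebra.EssFiniteType K L] {x : L}
    (hx : KaehlerDifferential.D K L x = 0) : IsAlgebraic K x := by
  by_contra htr
  have hinj : Function.Injective (Polynomial.aeval (R := K) x) :=
    transcendental_iff_injective.mp htr
  let : Algebra (Polynomial K) L := (Polynomial.aeval (R := K) x).toAlgebra
  have hmap : ∀ P : Polynomial K, algebraMap (Polynomial K) L P = Polynomial.aeval x P :=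
    fun _ => rfl
  have : IsScalarTower K (Polynomial K) L :=
    IsScalarTower.of_algHom (Polynomial.aeval (R := K) x)
  let : Algebra (RatFunc K) L := (IsFractionRing.lift (K := RatFunc K) hinj).toAlgebra
  have : IsScalarTower (Polynomial K) (RatFunc K) L := .of_algebraMap_eq fun P =>
    (IsFractionRing.lift_algebraMap (K := RatFunc K) hinj P).symm
  have : IsScalarTower K (RatFunc K) L := .to₁₃₄ K (Polynomial K) (RatFunc K) L
  have : Algebra.EssFiniteType (RatFunc K) L := .of_comp K _ _
  have : Algebra.FormallySmooth (Polynomial K) (RatFunc K) :=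
    .of_isLocalization (nonZeroDivisors (Polynomial K))
  have : Algebra.FormallySmooth (Polynomial K) L := .comp _ (RatFunc K) _
  have hzero :
      (1 : L) ⊗ₜ[Polynomial K] KaehlerDifferential.D K (Polynomial K) Polynomial.X = 0 := by
    obtain ⟨w, hw⟩ := (Algebra.H1Cotangent.exact_δ_mapBaseChange K (Polynomial K) L _).mp
      (show KaehlerDifferential.mapBaseChange K (Polynomial K) L
        (1 ⊗ₜ KaehlerDifferential.D K (Polynomial K) Polynomial.X) = 0 by
        simp [KaehlerDifferential.mapBaseChange_tmul, hmap, hx])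
    rw [← hw, Subsingleton.elim w 0, map_zero]
  have := congrArg (TensorProduct.rid (Polynomial K) L ∘
    (KaehlerDifferential.polynomialEquiv K).toLinearMap.lTensor L) hzero
  simp at this

theorem MvPolynomial.derivation_eq_sum_pderiv {R σ M : Type*} [CommRing R] [Fintype σ]
    [AddCommGroup M] [Module R M] [Module (MvPolynomial σ R) M]
    (D : Derivation R (MvPolynomial σ R) M) (f : MvPolynomial σ R) :
    D f = ∑ i, pderiv i f • D (X i) := by
  classical
  induction f using MvPolynomial.induction_on with
  | C a => simp [← algebraMap_eq]
  | add p q hp hq => simp [hp, hq, add_smul, Finset.sum_add_distrib]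
  | mul_X p j hp =>
    simp [hp, add_smul, mul_smul, Finset.sum_add_distrib, Finset.smul_sum, pderiv_X,
      Pi.single_apply, ite_smul, Derivation.leibniz]

/-- A polynomial is constant modulo every prime ideal containing its partial derivatives. -/
theorem MvPolynomial.exists_sub_C_mem_of_pderiv_mem {K σ : Type*} [Field K] [CharZero K]
    [IsAlgClosed K] [Fintype σ] (q : MvPolynomial σ K) (P : Ideal (MvPolynomial σ K)) [P.IsPrime]
    (hP : ∀ i, pderiv i q ∈ P) : ∃ a : K, q - C a ∈ P := by
  let A := MvPolynomial σ K ⧸ P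
  let L := FractionRing A
  have hD : KaehlerDifferential.D K L (algebraMap (MvPolynomial σ K) L q) = 0 := by
    have h := MvPolynomial.derivation_eq_sum_pderiv
      ((KaehlerDifferential.D K L).compAlgebraMap (MvPolynomial σ K)) q
    have hz : ∀ i, algebraMap (MvPolynomial σ K) L (pderiv i q) = 0 := fun i => by
      rw [IsScalarTower.algebraMap_apply _ A L, Ideal.Quotient.algebraMap_eq,
        Ideal.Quotient.eq_zero_iff_mem.mpr (hP i), map_zero]
    rw [Derivation.compAlgebraMap_apply] at h
    rw [h]
    refine Finset.sum_eq_zero fun i _ => ?_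
    rw [← IsScalarTower.algebraMap_smul L, hz, zero_smul]
  obtain ⟨a, ha⟩ := (isAlgebraic_of_kaehlerDifferential_eq_zero hD).isIntegral
    |>.mem_range_algebraMap_of_minpoly_splits (K := K) (IsAlgClosed.splits _)
  refine ⟨a, ?_⟩
  rw [← Ideal.Quotient.eq_zero_iff_mem]
  apply IsFractionRing.injective A L
  rw [map_zero, ← Ideal.Quotient.algebraMap_eq, ← IsScalarTower.algebraMap_apply _ A L,
    map_sub, ← ha, ← algebraMap_eq, ← IsScalarTower.algebraMap_apply, sub_self]

/-- A polynomial over an algebraically closed field of characteristic zero has only finitely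
many critical values. -/
theorem MvPolynomial.finite_criticalValues {K σ : Type*} [Field K] [CharZero K]
    [IsAlgClosed K] [Fintype σ] (q : MvPolynomial σ K) :
    {a : K | ∃ x : σ → K, (∀ i, eval x (pderiv i q) = 0) ∧ eval x q = a}.Finite := by
  let I := Ideal.span (Set.range fun i => pderiv i q)
  have hex : ∀ P ∈ I.minimalPrimes, ∃ a : K, q - C a ∈ P := fun P hP => by
    have := hP.1.1
    exact exists_sub_C_mem_of_pderiv_mem q P fun i => hP.1.2 (Ideal.subset_span ⟨i, rfl⟩)
  choose! a ha using hex
  refine ((I.finite_minimalPrimes_of_isNoetherianRing).image a).subset ?_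
  rintro _ ⟨x, hx, rfl⟩
  have hle : I ≤ RingHom.ker (eval x) := by
    rw [Ideal.span_le]
    rintro _ ⟨i, rfl⟩
    exact hx i
  have : (RingHom.ker (eval x)).IsPrime := RingHom.ker_isPrime _
  obtain ⟨P, hP, hPx⟩ := Ideal.exists_minimalPrimes_le hle
  refine ⟨P, hP, ?_⟩
  have := hPx (ha P hP)
  rw [RingHom.mem_ker, map_sub, eval_C, sub_eq_zero] at this
  exact this.symm

theorem MvPolynomial.IsHomogeneous.eval_smul {R σ : Type*} [CommSemiring R]
    {φ : MvPolynomial σ R} {n : ℕ} (hφ : φ.IsHomogeneous n) (r : R) (x : σ → R) :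
    eval (r • x) φ = r ^ n * eval x φ := by
  rw [eval_eq, eval_eq, Finset.mul_sum]
  refine Finset.sum_congr rfl fun s hs => ?_
  simp only [Pi.smul_apply, smul_eq_mul, mul_pow, Finset.prod_mul_distrib,
    Finset.prod_pow_eq_pow_sum, ← hφ.degree_eq_sum_deg_support hs]
  ring

theorem MvPolynomial.IsHomogeneous.mul_eval_smul_pderiv {R σ : Type*} [CommSemiring R]
    {φ : MvPolynomial σ R} {n : ℕ} (hφ : φ.IsHomogeneous n) (r : R) (x : σ → R) (j : σ) :
    r * eval (r • x) (pderiv j φ) = r ^ n * eval x (pderiv j φ) := by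
  rw [hφ.pderiv.eval_smul]
  cases n with
  | zero =>
    rw [totalDegree_eq_zero_iff_eq_C.mp (Nat.le_zero.mp hφ.totalDegree_le)]
    simp
  | succ n => rw [Nat.add_sub_cancel]; ring

theorem eval_homogenization (m d : ℕ) (g : MvPolynomial (Fin m) ℂ) (y : Fin (m + 1) → ℂ) :
    eval y (homogenization m d g) = ∑ i ∈ Finset.range (d + 1),
      eval (y ∘ Fin.castSucc) (homogeneousComponent i g) * y (Fin.last m) ^ (d - i) := by
  simp [homogenization, eval_rename]

theorem eval_pderiv_castSucc_homogenization (m d : ℕ) (g : MvPolynomial (Fin m) ℂ)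
    (y : Fin (m + 1) → ℂ) (j : Fin m) :
    eval y (pderiv j.castSucc (homogenization m d g)) = ∑ i ∈ Finset.range (d + 1),
      eval (y ∘ Fin.castSucc) (pderiv j (homogeneousComponent i g)) *
        y (Fin.last m) ^ (d - i) := by
  simp [homogenization, eval_rename, pderiv_rename (Fin.castSucc_injective m),
    pderiv_X_of_ne (Fin.castSucc_ne_last j).symm, Derivation.leibniz, Derivation.leibniz_pow,
    mul_comm]

theorem eval_pderiv_last_homogenization (m d : ℕ) (g : MvPolynomial (Fin m) ℂ)
    (y : Fin (m + 1) → ℂ) :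
    eval y (pderiv (Fin.last m) (homogenization m d g)) = ∑ i ∈ Finset.range (d + 1),
      eval (y ∘ Fin.castSucc) (homogeneousComponent i g) *
        ((d - i : ℕ) * y (Fin.last m) ^ (d - i - 1)) := by
  have hvars : ∀ φ : MvPolynomial (Fin m) ℂ,
      pderiv (Fin.last m) (rename Fin.castSucc φ) = 0 := fun φ => by
    classical
    refine pderiv_eq_zero_of_notMem_vars fun hmem => ?_
    obtain ⟨j, -, hj⟩ := Finset.mem_image.mp (vars_rename _ φ hmem)
    exact Fin.castSucc_ne_last j hj
  simp [homogenization, eval_rename, hvars, Derivation.leibniz, Derivation.leibniz_pow]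

theorem sum_range_homogeneousComponent {R σ : Type*} [CommSemiring R] {g : MvPolynomial σ R}
    {d : ℕ} (hg : g.totalDegree ≤ d) :
    ∑ i ∈ Finset.range (d + 1), homogeneousComponent i g = g := by
  conv_rhs => rw [← sum_homogeneousComponent g]
  refine (Finset.sum_subset (Finset.range_mono (by omega)) fun i _ hi => ?_).symm
  exact homogeneousComponent_eq_zero _ _ (by simpa using hi)

section Affine

variable {m d : ℕ} {g : MvPolynomial (Fin m) ℂ} {y : Fin (m + 1) → ℂ} {u : Fin m → ℂ}

theorem eval_homogenization_of_eq_smul (hg : g.totalDegree ≤ d)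
    (hu : y ∘ Fin.castSucc = y (Fin.last m) • u) :
    eval y (homogenization m d g) = y (Fin.last m) ^ d * eval u g := by
  conv_rhs => rw [← sum_range_homogeneousComponent hg, map_sum, Finset.mul_sum]
  rw [eval_homogenization, hu]
  refine Finset.sum_congr rfl fun i hi => ?_
  rw [(homogeneousComponent_isHomogeneous i g).eval_smul, mul_right_comm, ← pow_add,
    Nat.add_sub_of_le (Finset.mem_range_succ_iff.mp hi)]

theorem mul_eval_pderiv_castSucc_homogenization (hg : g.totalDegree ≤ d)
    (hu : y ∘ Fin.castSucc = y (Fin.last m) • u) (j : Fin m) :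
    y (Fin.last m) * eval y (pderiv j.castSucc (homogenization m d g)) =
      y (Fin.last m) ^ d * eval u (pderiv j g) := by
  conv_rhs => rw [← sum_range_homogeneousComponent hg, map_sum, map_sum, Finset.mul_sum]
  rw [eval_pderiv_castSucc_homogenization, hu, Finset.mul_sum]
  refine Finset.sum_congr rfl fun i hi => ?_
  rw [← mul_assoc, (homogeneousComponent_isHomogeneous i g).mul_eval_smul_pderiv,
    mul_right_comm, ← pow_add, Nat.add_sub_of_le (Finset.mem_range_succ_iff.mp hi)]

end Affine

section Infinity

variable {m d : ℕ} {y : Fin (m + 1) → ℂ}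

theorem eval_pderiv_castSucc_homogenization_of_last_eq_zero (g : MvPolynomial (Fin m) ℂ)
    (hy : y (Fin.last m) = 0) (j : Fin m) :
    eval y (pderiv j.castSucc (homogenization m d g)) =
      eval (y ∘ Fin.castSucc) (pderiv j (homogeneousComponent d g)) := by
  rw [eval_pderiv_castSucc_homogenization, Finset.sum_eq_single d]
  · simp
  · intro i hi hne
    have := Finset.mem_range.mp hi
    rw [hy, zero_pow (by omega), mul_zero]
  · simp

theorem eval_pderiv_last_homogenization_of_last_eq_zero (g : MvPolynomial (Fin m) ℂ)
    (hd : 1 ≤ d) (hy : y (Fin.last m) = 0) :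
    eval y (pderiv (Fin.last m) (homogenization m d g)) =
      eval (y ∘ Fin.castSucc) (homogeneousComponent (d - 1) g) := by
  rw [eval_pderiv_last_homogenization, Finset.sum_eq_single (d - 1)]
  · simp [Nat.sub_sub_self hd]
  · intro i hi hne
    have := Finset.mem_range.mp hi
    obtain rfl | hlt : i = d ∨ i < d - 1 := by omega
    · simp
    · rw [hy, zero_pow (by omega), mul_zero, mul_zero]
  · intro hmem
    exact absurd (Finset.mem_range.mpr (by omega)) hmem

end Infinity

/-- Let `d ≥ 1`, `f` homogeneous of degree `d` in `m` variables over
`ℂ`, `h` homogeneous of degree `d-1` with `h x ≠ 0` for every nonzero `x` at which all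
partial derivatives of `f` vanish, and `p` of total degree at most `d-2`. For `c : ℂ`,
set `g_c = f + h + p + c` and let `G_c` be its degree-`d` homogenization. Then for all
but finitely many `c : ℂ` there is no nonzero `y : Fin (m+1) → ℂ` at which `G_c` and all
its `m+1` partial derivatives vanish; i.e. the projective hypersurface `{G_c = 0}` in
`ℙ^m` is smooth for all but finitely many constant terms `c`. -/
theorem homogenization_smooth_for_generic_constant
    (m d : ℕ) (hd : 1 ≤ d)
    (f h p : MvPolynomial (Fin m) ℂ)
    (hf : f.IsHomogeneous d) (hh : h.IsHomogeneous (d - 1))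
    (hsing : ∀ x : Fin m → ℂ, x ≠ 0 →
      (∀ j : Fin m, eval x (pderiv j f) = 0) → eval x h ≠ 0)
    (hp : p.totalDegree ≤ d - 2) :
    {c : ℂ | ∃ y : Fin (m + 1) → ℂ, y ≠ 0 ∧
        eval y (homogenization m d (f + h + p + C c)) = 0 ∧
        ∀ k : Fin (m + 1),
          eval y (pderiv k (homogenization m d (f + h + p + C c))) = 0}.Finite := by
  refine (((finite_criticalValues (f + h + p)).image Neg.neg).union
    (Set.finite_singleton (-coeff 0 (h + p)))).subset ?_
  rintro c ⟨y, hy0, hy, hdy⟩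
  have hpc : (p + C c).totalDegree ≤ d - 2 :=
    (totalDegree_add _ _).trans (max_le hp (by simp))
  have hg : (f + h + p + C c).totalDegree ≤ d := by
    rw [add_assoc]
    refine (totalDegree_add _ _).trans (max_le ((totalDegree_add _ _).trans
      (max_le hf.totalDegree_le (hh.totalDegree_le.trans (by omega)))) (hpc.trans (by omega)))
  by_cases hz : y (Fin.last m) = 0
  · have hx0 : y ∘ Fin.castSucc ≠ 0 := fun hx => hy0 <| funext fun k => by
      cases k using Fin.lastCases with
      | last => exact hz
      | cast j => exact congrFun hx j
    have hlast := hdy (Fin.last m)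
    rw [eval_pderiv_last_homogenization_of_last_eq_zero _ hd hz] at hlast
    obtain rfl | hd2 : d = 1 ∨ 2 ≤ d := by omega
    · right
      have hf0 : coeff 0 f = 0 := hf.coeff_eq_zero (by simp)
      simp only [Nat.sub_self, homogeneousComponent_zero, eval_C, coeff_add, hf0, coeff_zero_C,
        zero_add] at hlast
      rw [Set.mem_singleton_iff, coeff_add]
      exact eq_neg_of_add_eq_zero_right hlast
    · exfalso
      have hcd : homogeneousComponent d (f + h + p + C c) = f := by
        rw [add_assoc, map_add, map_add, homogeneousComponent_eq_zero _ (p + C c) (by omega),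
          homogeneousComponent_eq_zero _ h (by have := hh.totalDegree_le; omega),
          homogeneousComponent_eq_self hf, add_zero, add_zero]
      have hcd' : homogeneousComponent (d - 1) (f + h + p + C c) = h := by
        rw [add_assoc, map_add, map_add, homogeneousComponent_eq_zero _ (p + C c) (by omega),
          homogeneousComponent_of_mem hf, if_neg (by omega),
          homogeneousComponent_eq_self hh, add_zero, zero_add]
      rw [hcd'] at hlast
      refine hsing _ hx0 (fun j => ?_) hlast
      rw [← hdy j.castSucc, eval_pderiv_castSucc_homogenization_of_last_eq_zero _ hz, hcd]
  · left
    have hu : y ∘ Fin.castSucc = y (Fin.last m) • ((y (Fin.last m))⁻¹ • (y ∘ Fin.castSucc)) :=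
      (smul_inv_smul₀ hz _).symm
    refine ⟨-c, ⟨(y (Fin.last m))⁻¹ • (y ∘ Fin.castSucc), fun j => ?_, ?_⟩, neg_neg c⟩
    · have := mul_eval_pderiv_castSucc_homogenization hg hu j
      rw [hdy, mul_zero, zero_eq_mul] at this
      simpa using this.resolve_left (pow_ne_zero _ hz)
    · have := eval_homogenization_of_eq_smul hg hu
      rw [hy, zero_eq_mul] at this
      have := this.resolve_left (pow_ne_zero _ hz)
      rw [map_add, eval_C] at this
      exact eq_neg_of_add_eq_zero_left this
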